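/- There is a universal constant c > 0 such that for every integer ℓ ≥ 1, every three times differentiable f : ℝ^d → ℝ, and every x ∈ ℝ^d, with A := ∇³f_x: ( E_{p ~ N(0, I_d)} ‖A[p,p,·]‖^{2ℓ} )^{1/ℓ} ≤ c ( ℓ² ‖A‖_{{1,2,3}}² + ℓ² d ‖A‖_{{1,2}{3}}² ), where A[p,p,·] ∈ ℝ^d has k-th coordinate Σ_{i,j} A_{ijk} p_i p_j. In particular, if f is γL^{3/2}-strongly Hessian Lipschitz the bound is O(γ² ℓ² L³ d). -/

import Mathlib

open MeasureTheory Real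
open scoped ENNReal NNReal

noncomputable section

/-- The Euclidean space `ℝ^d`. -/
abbrev Euc (d : ℕ) := EuclideanSpace ℝ (Fin d)

/-- `leapfrog f η k (q₀,p₀)` is the `k`-th leapfrog iterate with step size `η` for the
potential `f`, starting at `(q₀,p₀)`. -/
def leapfrog {d : ℕ} (f : Euc d → ℝ) (η : ℝ) : ℕ → Euc d × Euc d → Euc d × Euc d
  | 0, z => z
  | (k+1), z =>
      let w := leapfrog f η k z
      let q' := w.1 + η • w.2 - (η^2/2) • gradient f w.1
      (q', w.2 - (η/2) • gradient f w.1 - (η/2) • gradient f q')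

/-- `f` is `L`-smooth: the Hessian has operator norm at most `L` everywhere. -/
def LSmooth {d : ℕ} (f : Euc d → ℝ) (L : ℝ) : Prop :=
  ∀ x, ‖fderiv ℝ (gradient f) x‖ ≤ L

/-- The entries of the third-derivative tensor of `f` at `x`. -/
def tensor3 {ι : Type*} [Fintype ι] [DecidableEq ι]
    (f : EuclideanSpace ℝ ι → ℝ) (x : EuclideanSpace ℝ ι) (i j k : ι) : ℝ :=
  iteratedFDeriv ℝ 3 f x
    ![EuclideanSpace.single i 1, EuclideanSpace.single j 1, EuclideanSpace.single k 1]

/-- The `{1,2,3}`-norm (Frobenius norm) of a 3-tensor. -/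
def norm123 {ι : Type*} [Fintype ι] (A : ι → ι → ι → ℝ) : ℝ :=
  Real.sqrt (∑ i, ∑ j, ∑ k, (A i j k)^2)

/-- The `{1,2}{3}`-norm of a 3-tensor. -/
def norm12_3 {ι : Type*} [Fintype ι] (A : ι → ι → ι → ℝ) : ℝ :=
  sSup { s | ∃ (X : ι → ι → ℝ) (y : ι → ℝ), (∑ i, ∑ j, (X i j)^2) ≤ 1 ∧
    (∑ k, (y k)^2) ≤ 1 ∧ s = ∑ i, ∑ j, ∑ k, A i j k * X i j * y k }

/-- `f` is `γ L^{3/2}`-strongly Hessian Lipschitz. -/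
def StronglyHessLip {d : ℕ} (f : Euc d → ℝ) (γ L : ℝ) : Prop :=
  ∀ x, norm12_3 (tensor3 f x) ≤ γ * L ^ ((3:ℝ)/2)

/-- Distance between two sets. -/
def setDistance {α : Type*} [PseudoMetricSpace α] (S T : Set α) : ℝ :=
  sInf { r | ∃ x ∈ S, ∃ y ∈ T, r = dist x y }

/-- Cheeger isoperimetric inequality with coefficient `ψ`. -/
def CheegerIso {d : ℕ} (μ : Measure (Euc d)) (ψ : ℝ) : Prop :=
  ∀ S1 S2 S3 : Set (Euc d), MeasurableSet S1 → MeasurableSet S2 → MeasurableSet S3 →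
    Disjoint S1 S2 → Disjoint S1 S3 → Disjoint S2 S3 → S1 ∪ S2 ∪ S3 = Set.univ →
    ψ * setDistance S1 S2 * (μ S1).toReal * (μ S2).toReal ≤ (μ S3).toReal

/-- The probability measure proportional to `e^{-f}`. -/
def targetMeasure {d : ℕ} (f : Euc d → ℝ) : Measure (Euc d) :=
  ((volume.withDensity fun x => ENNReal.ofReal (Real.exp (-f x))) Set.univ)⁻¹ •
    (volume.withDensity fun x => ENNReal.ofReal (Real.exp (-f x)))

/-- The standard Gaussian measure `N(0, I_d)` on `ℝ^d`. -/
def stdGaussian (d : ℕ) : Measure (Euc d) :=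
  Measure.map (⇑(EuclideanSpace.equiv (Fin d) ℝ).symm)
    (Measure.pi fun _ : Fin d => ProbabilityTheory.gaussianReal 0 1)

/-- Metropolis acceptance probability of the HMC proposal. -/
def accProb {d : ℕ} (f : Euc d → ℝ) (K : ℕ) (η : ℝ) (q p : Euc d) : ℝ :=
  min 1 (Real.exp (-(f (leapfrog f η K (q,p)).1) - ‖(leapfrog f η K (q,p)).2‖^2/2
    + f q + ‖p‖^2/2))

/-- One step of Metropolized HMC with `K` leapfrog steps and step size `η`, from `q`. -/
def hmcKernel {d : ℕ} (f : Euc d → ℝ) (K : ℕ) (η : ℝ) (q : Euc d) : Measure (Euc d) :=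
  (stdGaussian d).bind fun p =>
    ENNReal.ofReal (accProb f K η q p) • Measure.dirac (leapfrog f η K (q,p)).1 +
    ENNReal.ofReal (1 - accProb f K η q p) • Measure.dirac q

/-- One step of the lazy version of Metropolized HMC. -/
def lazyHMC {d : ℕ} (f : Euc d → ℝ) (K : ℕ) (η : ℝ) (q : Euc d) : Measure (Euc d) :=
  (2:ℝ≥0∞)⁻¹ • Measure.dirac q + (2:ℝ≥0∞)⁻¹ • hmcKernel f K η q

/-- The law of the lazy Metropolized HMC chain after `n` steps started from `μ₀`. -/
def hmcIter {d : ℕ} (f : Euc d → ℝ) (K : ℕ) (η : ℝ) (μ0 : Measure (Euc d)) :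
    ℕ → Measure (Euc d)
  | 0 => μ0
  | (n+1) => (hmcIter f K η μ0 n).bind (lazyHMC f K η)

/-- Total variation distance between two measures. -/
def tvDist {α : Type*} [MeasurableSpace α] (P Q : Measure α) : ℝ :=
  sSup { r | ∃ A, MeasurableSet A ∧ r = |(P A).toReal - (Q A).toReal| }

/-- `ε`-mixing time of lazy Metropolized HMC started from `μ₀`, targetting `μ ∝ e^{-f}`. -/
def mixingTime {d : ℕ} (f : Euc d → ℝ) (K : ℕ) (η : ℝ) (μ0 : Measure (Euc d)) (ε : ℝ) : ℕ :=
  sInf { n : ℕ | tvDist (hmcIter f K η μ0 n) (targetMeasure f) ≤ ε }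

/-- `μ₀` is `M`-warm with respect to `μ`. -/
def Warm {α : Type*} [MeasurableSpace α] (μ0 μ : Measure α) (M : ℝ) : Prop :=
  ∀ S : Set α, MeasurableSet S → μ0 S ≤ ENNReal.ofReal M * μ S

/-- `e^{-f}` has subexponential tail. -/
def SubexpTail {d : ℕ} (f : Euc d → ℝ) : Prop :=
  ∃ lam > (0:ℝ), Filter.Tendsto (fun x : Euc d => Real.exp (lam * ‖x‖) * Real.exp (-f x))
    (Bornology.cobounded _) (nhds 0)

end

section MomentBounds

open ProbabilityTheory

lemma eLpNorm_natCast_pow {α : Type*} [MeasurableSpace α] {μ : Measure α} (f : α → ℝ) {n : ℕ}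
    (hn : n ≠ 0) : eLpNorm f n μ ^ n = ∫⁻ x, ‖f x‖ₑ ^ n ∂μ := by
  have h := eLpNorm_nnreal_pow_eq_lintegral (μ := μ) (f := f) (p := (n : ℝ≥0)) (by exact_mod_cast hn)
  simpa using h

/-- Minkowski's inequality for an `ℓ²`-combination of functions, in an even `L^p` norm. -/
lemma eLpNorm_sqrt_sum_sq_le {α κ : Type*} [MeasurableSpace α] [Fintype κ] {μ : Measure α}
    {X : κ → α → ℝ} {a : κ → ℝ} {ℓ : ℕ} (hℓ : 1 ≤ ℓ) (hX : ∀ k, AEStronglyMeasurable (X k) μ)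
    (ha : ∀ k, 0 ≤ a k) (h : ∀ k, eLpNorm (X k) (2 * ℓ : ℕ) μ ≤ ENNReal.ofReal (a k)) :
    eLpNorm (fun p => √(∑ k, X k p ^ 2)) (2 * ℓ : ℕ) μ ≤ ENNReal.ofReal √(∑ k, a k ^ 2) := by
  have hsq (g : α → ℝ) :
      eLpNorm (fun p => g p ^ 2) ℓ μ = eLpNorm g (2 * ℓ : ℕ) μ ^ 2 := by
    have := eLpNorm_norm_rpow (μ := μ) (p := (ℓ : ℝ≥0∞)) g (q := 2) two_pos
    simpa [mul_comm] using this
  rw [← ENNReal.pow_le_pow_left_iff two_ne_zero, ← hsq, ← ENNReal.ofReal_pow (by positivity),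
    Real.sq_sqrt (by positivity)]
  have h1 : (fun p => √(∑ k, X k p ^ 2) ^ 2) = ∑ k, fun p => X k p ^ 2 := by
    ext p
    rw [Real.sq_sqrt (by positivity), Finset.sum_apply]
  rw [h1]
  refine (eLpNorm_sum_le (fun k _ => (hX k).pow 2) (by exact_mod_cast hℓ)).trans ?_
  rw [ENNReal.ofReal_sum_of_nonneg (fun k _ => by positivity)]
  gcongr with k
  rw [ENNReal.ofReal_pow (ha k)]
  exact (hsq (X k)).trans_le (pow_le_pow_left' (h k) 2)

lemma eLpNorm_id_gaussianReal_le {ℓ : ℕ} (hℓ : 1 ≤ ℓ) :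
    eLpNorm (fun x => x) (2 * ℓ : ℕ) (gaussianReal 0 1) ≤ ENNReal.ofReal (4 * √ℓ) := by
  have hℓ0 : (0 : ℝ) < ℓ := by exact_mod_cast hℓ
  rw [← ENNReal.pow_le_pow_left_iff (n := 2 * ℓ) (by omega), eLpNorm_natCast_pow _ (by omega),
    ← ENNReal.ofReal_pow (by positivity)]
  set t : ℝ := √(2 * ℓ) with ht
  have ht0 : 0 < t := by positivity
  have ht2 : t ^ 2 = 2 * ℓ := Real.sq_sqrt (by positivity)
  have hpt (x : ℝ) : ‖x‖ₑ ^ (2 * ℓ) ≤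
      ENNReal.ofReal (t ^ (2 * ℓ) * (rexp (t * x) + rexp (-t * x))) := by
    rw [← ofReal_norm, ← ENNReal.ofReal_pow (norm_nonneg _)]
    refine ENNReal.ofReal_le_ofReal ?_
    have h := rpow_abs_le_mul_max_exp x (t := t) (p := ((2 * ℓ : ℕ) : ℝ)) (by positivity) ht0.ne'
    rw [Real.rpow_natCast, Real.rpow_natCast, abs_of_pos ht0] at h
    have h2 : ((2 * ℓ : ℕ) : ℝ) / t = t := by
      rw [div_eq_iff ht0.ne', ← sq, ht2]; push_cast; rfl
    rw [h2] at h
    refine h.trans ?_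
    gcongr
    exact max_le_add_of_nonneg (exp_nonneg _) (exp_nonneg _)
  have hint (s : ℝ) : ∫ x, rexp (s * x) ∂(gaussianReal 0 1) = rexp (s ^ 2 / 2) := by
    have := congrFun (mgf_fun_id_gaussianReal (μ := 0) (v := 1)) s
    simpa [mgf] using this
  refine (lintegral_mono hpt).trans ?_
  rw [← ofReal_integral_eq_lintegral_ofReal
    (Integrable.const_mul ((integrable_exp_mul_gaussianReal t).fun_add
      (integrable_exp_mul_gaussianReal (-t))) _)
    (ae_of_all _ fun x => by positivity)]
  refine ENNReal.ofReal_le_ofReal ?_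
  rw [integral_const_mul, integral_add (integrable_exp_mul_gaussianReal t)
    (integrable_exp_mul_gaussianReal (-t)), hint, hint, neg_sq, ht2, pow_mul, ht2, pow_mul,
    mul_pow 4, Real.sq_sqrt hℓ0.le, mul_pow, mul_pow]
  have he : rexp (2 * ℓ / 2) ≤ 4 ^ ℓ := by
    rw [mul_div_cancel_left₀ _ two_ne_zero, ← Real.exp_one_pow]
    gcongr
    linarith [Real.exp_one_lt_three]
  have h2 : (2 : ℝ) ≤ 2 ^ ℓ := by
    simpa using pow_le_pow_right₀ (one_le_two : (1 : ℝ) ≤ 2) hℓ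
  calc 2 ^ ℓ * (ℓ : ℝ) ^ ℓ * (rexp (2 * ℓ / 2) + rexp (2 * ℓ / 2))
      = 2 ^ ℓ * (ℓ : ℝ) ^ ℓ * (2 * rexp (2 * ℓ / 2)) := by ring
    _ ≤ 2 ^ ℓ * (ℓ : ℝ) ^ ℓ * (2 ^ ℓ * 4 ^ ℓ) := by gcongr
    _ = (4 ^ 2) ^ ℓ * (ℓ : ℝ) ^ ℓ := by
      rw [show (4 : ℝ) ^ 2 = 2 * 2 * 4 by norm_num, mul_pow, mul_pow]; ring

lemma stdGaussian_eq (d : ℕ) : stdGaussian d = ProbabilityTheory.stdGaussian (Euc d) := by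
  rw [← map_pi_eq_stdGaussian]
  rfl

instance (d : ℕ) : IsGaussian (stdGaussian d) := by
  rw [stdGaussian_eq]; infer_instance

lemma eLpNorm_linear_le {d ℓ : ℕ} (hℓ : 1 ≤ ℓ) (a : Fin d → ℝ) :
    eLpNorm (fun v : Euc d => ∑ i, a i * v i) (2 * ℓ : ℕ) (stdGaussian d) ≤
      ENNReal.ofReal (4 * √ℓ * √(∑ i, a i ^ 2)) := by
  rw [stdGaussian_eq]
  set μ := ProbabilityTheory.stdGaussian (Euc d)
  set L : StrongDual ℝ (Euc d) := innerSL ℝ (WithLp.toLp 2 a)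
  have hL : (fun v : Euc d => ∑ i, a i * v i) = L := by
    ext v
    simp [L, PiLp.inner_apply, mul_comm]
  have hn : ‖L‖ = √(∑ i, a i ^ 2) := by
    simp [L, EuclideanSpace.norm_eq]
  have hmap : μ.map L = (gaussianReal 0 1).map (fun x => ‖L‖ * x) := by
    rw [IsGaussian.map_eq_gaussianReal, integral_strongDual_stdGaussian, variance_dual_stdGaussian,
      gaussianReal_map_const_mul]
    congr 1
    · simp
    · ext; simp
  have h1 : eLpNorm (fun x : ℝ => x) (2 * ℓ : ℕ) (μ.map L) = eLpNorm L (2 * ℓ : ℕ) μ :=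
    eLpNorm_map_measure aestronglyMeasurable_id L.continuous.aemeasurable
  rw [hL, ← h1, hmap, eLpNorm_map_measure (by fun_prop) (by fun_prop)]
  have h2 : (fun x : ℝ => x) ∘ (fun x => ‖L‖ * x) = ‖L‖ • fun x : ℝ => x := rfl
  rw [h2, eLpNorm_const_smul, ← hn, mul_comm, ENNReal.ofReal_mul (by positivity), enorm_norm,
    ← ofReal_norm L]
  gcongr
  exact eLpNorm_id_gaussianReal_le hℓ

/-- An `L^p` bound on a product space from bounds on the slices. -/
lemma eLpNorm_prod_le_of_slice {α β : Type*} [MeasurableSpace α] [MeasurableSpace β]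
    {μ : Measure α} {ν : Measure β} [SFinite μ] [SFinite ν] {F : α × β → ℝ} {g : β → ℝ} {n : ℕ}
    (hn : n ≠ 0) (hF : Measurable F)
    (h : ∀ y, eLpNorm (fun x => F (x, y)) n μ ≤ ‖g y‖ₑ) :
    eLpNorm F n (μ.prod ν) ≤ eLpNorm g n ν := by
  rw [← ENNReal.pow_le_pow_left_iff hn, eLpNorm_natCast_pow _ hn, eLpNorm_natCast_pow _ hn,
    lintegral_prod_symm _ (by fun_prop)]
  refine lintegral_mono fun y => ?_
  rw [← eLpNorm_natCast_pow _ hn]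
  gcongr
  exact h y

lemma eLpNorm_bilinear_le {d ℓ : ℕ} (hℓ : 1 ≤ ℓ) (M : Fin d → Fin d → ℝ) :
    eLpNorm (fun z : Euc d × Euc d => ∑ i, ∑ j, M i j * z.1 i * z.2 j) (2 * ℓ : ℕ)
      ((stdGaussian d).prod (stdGaussian d)) ≤
      ENNReal.ofReal (16 * ℓ * √(∑ i, ∑ j, M i j ^ 2)) := by
  refine (eLpNorm_prod_le_of_slice
    (g := fun v => 4 * √ℓ * √(∑ i, (∑ j, M i j * v j) ^ 2)) (by omega)
    (by fun_prop) fun v => ?_).trans ?_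
  · rw [Real.enorm_of_nonneg (by positivity)]
    convert eLpNorm_linear_le hℓ (fun i => ∑ j, M i j * v j) using 2
    ext u
    refine Finset.sum_congr rfl fun i _ => ?_
    rw [Finset.sum_mul]
    exact Finset.sum_congr rfl fun j _ => by ring
  · have h := eLpNorm_sqrt_sum_sq_le (μ := stdGaussian d) hℓ
      (X := fun i v => ∑ j, M i j * v j) (a := fun i => 4 * √ℓ * √(∑ j, M i j ^ 2))
      (fun i => by fun_prop) (fun i => by positivity) fun i => eLpNorm_linear_le hℓ (M i)
    have h2 : (fun v : Euc d => 4 * √ℓ * √(∑ i, (∑ j, M i j * v j) ^ 2)) =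
      (4 * √ℓ) • fun v : Euc d => √(∑ i, (∑ j, M i j * v j) ^ 2) := rfl
    rw [h2, eLpNorm_const_smul, Real.enorm_of_nonneg (by positivity)]
    refine (mul_le_mul_right h _).trans_eq ?_
    rw [← ENNReal.ofReal_mul (by positivity)]
    congr 1
    simp_rw [mul_pow, Real.sq_sqrt (Finset.sum_nonneg fun j _ => sq_nonneg (M _ j)),
      ← Finset.mul_sum]
    rw [Real.sqrt_mul (by positivity), ← mul_pow, Real.sqrt_sq (by positivity)]
    have := Real.mul_self_sqrt (Nat.cast_nonneg (α := ℝ) ℓ)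
    linear_combination (16 * √(∑ i, ∑ j, M i j ^ 2)) * this

/-- Symmetrization: centering a function costs no more than subtracting an independent copy. -/
lemma eLpNorm_sub_integral_le {α : Type*} [MeasurableSpace α] {μ : Measure α}
    [IsProbabilityMeasure μ] {F : α → ℝ} (hF : Measurable F) (hFi : Integrable F μ) {n : ℕ}
    (hn : n ≠ 0) :
    eLpNorm (fun p => F p - ∫ q, F q ∂μ) n μ ≤
      eLpNorm (fun z : α × α => F z.1 - F z.2) n (μ.prod μ) := by
  rw [← ENNReal.pow_le_pow_left_iff hn, eLpNorm_natCast_pow _ hn, eLpNorm_natCast_pow _ hn,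
    lintegral_prod _ (by fun_prop)]
  refine lintegral_mono fun p => ?_
  rw [← eLpNorm_natCast_pow (fun q => F p - F q) hn]
  gcongr
  calc ‖F p - ∫ q, F q ∂μ‖ₑ = ‖∫ q, (F p - F q) ∂μ‖ₑ := by
        rw [integral_sub (integrable_const _) hFi]; simp
    _ ≤ ∫⁻ q, ‖F p - F q‖ₑ ∂μ := enorm_integral_le_lintegral_enorm _
    _ = eLpNorm (fun q => F p - F q) 1 μ := eLpNorm_one_eq_lintegral_enorm.symm
    _ ≤ eLpNorm (fun q => F p - F q) n μ :=
        eLpNorm_le_eLpNorm_of_exponent_le (by exact_mod_cast Nat.one_le_iff_ne_zero.2 hn)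
          (by fun_prop)

lemma integrable_coord_mul_coord {d : ℕ} (i j : Fin d) :
    Integrable (fun p : Euc d => p i * p j) (stdGaussian d) := by
  have h (i : Fin d) : MemLp (fun p : Euc d => p i) 2 (stdGaussian d) :=
    (IsGaussian.memLp_id (stdGaussian d) 2 (by simp)).continuousLinearMap_comp
      (EuclideanSpace.proj (𝕜 := ℝ) i)
  exact (h i).integrable_mul (h j)

lemma integral_coord_mul_coord {d : ℕ} (i j : Fin d) :
    ∫ p : Euc d, p i * p j ∂(stdGaussian d) = if i = j then 1 else 0 := by
  have h := covarianceBilin_apply (μ := ProbabilityTheory.stdGaussian (Euc d))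
    (IsGaussian.memLp_id _ 2 (by simp)) (EuclideanSpace.single i 1) (EuclideanSpace.single j 1)
  rw [covarianceBilin_stdGaussian] at h
  simp only [id_eq, integral_id_stdGaussian, sub_zero] at h
  rw [stdGaussian_eq]
  simpa [eq_comm, PiLp.single_apply, innerSL_apply_apply ℝ,
    EuclideanSpace.inner_single_left] using h.symm

lemma integrable_quadratic {d : ℕ} (M : Fin d → Fin d → ℝ) :
    Integrable (fun p : Euc d => ∑ i, ∑ j, M i j * p i * p j) (stdGaussian d) := by
  simp_rw [mul_assoc]
  exact integrable_finsetSum _ fun i _ => integrable_finsetSum _ fun j _ =>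
    (integrable_coord_mul_coord i j).const_mul _

lemma integral_quadratic {d : ℕ} (M : Fin d → Fin d → ℝ) :
    ∫ p : Euc d, ∑ i, ∑ j, M i j * p i * p j ∂(stdGaussian d) = ∑ i, M i i := by
  simp_rw [mul_assoc]
  rw [integral_finsetSum _ fun i _ => integrable_finsetSum _ fun j _ =>
    (integrable_coord_mul_coord i j).const_mul _]
  refine Finset.sum_congr rfl fun i _ => ?_
  rw [integral_finsetSum _ fun j _ => (integrable_coord_mul_coord i j).const_mul _]
  simp [integral_const_mul, integral_coord_mul_coord]

lemma eLpNorm_quadratic_sub_le {d ℓ : ℕ} (hℓ : 1 ≤ ℓ) (M : Fin d → Fin d → ℝ) :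
    eLpNorm (fun z : Euc d × Euc d =>
        (∑ i, ∑ j, M i j * z.1 i * z.1 j) - ∑ i, ∑ j, M i j * z.2 i * z.2 j) (2 * ℓ : ℕ)
      ((stdGaussian d).prod (stdGaussian d)) ≤
      ENNReal.ofReal (32 * ℓ * √(∑ i, ∑ j, M i j ^ 2)) := by
  have hrot : ((stdGaussian d).prod (stdGaussian d)).map
      (ContinuousLinearMap.rotation (-(π / 4))) = (stdGaussian d).prod (stdGaussian d) := by
    refine IsGaussian.map_rotation_eq_self_of_forall_strongDual_eq_zero (fun L => ?_) _
    rw [stdGaussian_eq]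
    exact integral_strongDual_stdGaussian L
  have hcomm (g : Fin d → Fin d → ℝ) : ∑ i, ∑ j, M j i * g i j = ∑ i, ∑ j, M i j * g j i :=
    Finset.sum_comm
  rw [← hrot, eLpNorm_map_measure (by fun_prop) (by fun_prop)]
  have hfun : (fun z : Euc d × Euc d =>
        (∑ i, ∑ j, M i j * z.1 i * z.1 j) - ∑ i, ∑ j, M i j * z.2 i * z.2 j) ∘
      (ContinuousLinearMap.rotation (-(π / 4))) =
      fun z : Euc d × Euc d => ∑ i, ∑ j, (-(M i j + M j i)) * z.1 i * z.2 j := by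
    ext z
    have hs : (√2 / 2) ^ 2 = (1 / 2 : ℝ) := by
      rw [div_pow, Real.sq_sqrt zero_le_two]; norm_num
    simp only [Function.comp_apply, ContinuousLinearMap.rotation_apply, Real.cos_neg, Real.sin_neg,
      Real.cos_pi_div_four, Real.sin_pi_div_four, PiLp.add_apply, PiLp.smul_apply, smul_eq_mul,
      neg_add, add_mul, Finset.sum_add_distrib, neg_mul, Finset.sum_neg_distrib, neg_neg]
    simp only [mul_assoc, hcomm]
    simp only [← Finset.sum_add_distrib, ← Finset.sum_sub_distrib, ← Finset.sum_neg_distrib]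
    refine Finset.sum_congr rfl fun i _ => Finset.sum_congr rfl fun j _ => ?_
    linear_combination (-2 * M i j * (z.1 i * z.2 j + z.1 j * z.2 i)) * hs
  rw [hfun]
  refine (eLpNorm_bilinear_le hℓ fun i j => -(M i j + M j i)).trans (ENNReal.ofReal_le_ofReal ?_)
  have hle : ∑ i, ∑ j, (-(M i j + M j i)) ^ 2 ≤ 2 ^ 2 * ∑ i, ∑ j, M i j ^ 2 := by
    have hT : ∑ i, ∑ j, M j i ^ 2 = ∑ i, ∑ j, M i j ^ 2 := Finset.sum_comm
    calc ∑ i, ∑ j, (-(M i j + M j i)) ^ 2 ≤ ∑ i, ∑ j, (2 * M i j ^ 2 + 2 * M j i ^ 2) := by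
          gcongr with i _ j _
          nlinarith [sq_nonneg (M i j - M j i)]
      _ = 2 ^ 2 * ∑ i, ∑ j, M i j ^ 2 := by
          simp only [Finset.sum_add_distrib, ← Finset.mul_sum, hT]; ring
  calc 16 * ℓ * √(∑ i, ∑ j, (-(M i j + M j i)) ^ 2)
      ≤ 16 * ℓ * √(2 ^ 2 * ∑ i, ∑ j, M i j ^ 2) := by gcongr
    _ = 32 * ℓ * √(∑ i, ∑ j, M i j ^ 2) := by
        rw [Real.sqrt_mul (by positivity), Real.sqrt_sq zero_le_two]; ring

lemma eLpNorm_quadratic_le {d ℓ : ℕ} (hℓ : 1 ≤ ℓ) (M : Fin d → Fin d → ℝ) :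
    eLpNorm (fun p : Euc d => ∑ i, ∑ j, M i j * p i * p j) (2 * ℓ : ℕ) (stdGaussian d) ≤
      ENNReal.ofReal (|∑ i, M i i| + 32 * ℓ * √(∑ i, ∑ j, M i j ^ 2)) := by
  set F : Euc d → ℝ := fun p => ∑ i, ∑ j, M i j * p i * p j with hF
  have hFm : Measurable F := by fun_prop
  have hdec : F = (fun _ => ∑ i, M i i) + fun p => F p - ∫ q, F q ∂(stdGaussian d) := by
    ext p
    simp [hF, integral_quadratic]
  have hp : (1 : ℝ≥0∞) ≤ (2 * ℓ : ℕ) := by exact_mod_cast (by omega : 1 ≤ 2 * ℓ)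
  rw [hdec]
  refine (eLpNorm_add_le (by fun_prop) (by fun_prop) hp).trans ?_
  rw [ENNReal.ofReal_add (abs_nonneg _) (by positivity)]
  gcongr
  · rw [eLpNorm_const _ (by positivity) (IsProbabilityMeasure.ne_zero _)]
    simp [← Real.enorm_eq_ofReal_abs]
  · exact (eLpNorm_sub_integral_le hFm (integrable_quadratic M) (by omega)).trans
      (eLpNorm_quadratic_sub_le hℓ M)

lemma bddAbove_norm12_3 {ι : Type*} [Fintype ι] (A : ι → ι → ι → ℝ) :
    BddAbove { s | ∃ (X : ι → ι → ℝ) (y : ι → ℝ), (∑ i, ∑ j, (X i j)^2) ≤ 1 ∧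
      (∑ k, (y k)^2) ≤ 1 ∧ s = ∑ i, ∑ j, ∑ k, A i j k * X i j * y k } := by
  refine ⟨∑ i, ∑ j, ∑ k, |A i j k|, ?_⟩
  rintro _ ⟨X, y, hX, hy, rfl⟩
  gcongr with i _ j _ k _
  have hXij : |X i j| ≤ 1 := by
    rw [← sq_le_one_iff_abs_le_one]
    calc X i j ^ 2 ≤ ∑ j, X i j ^ 2 :=
          Finset.single_le_sum (f := fun j => X i j ^ 2) (fun _ _ => sq_nonneg _)
            (Finset.mem_univ j)
      _ ≤ ∑ i, ∑ j, X i j ^ 2 :=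
          Finset.single_le_sum (f := fun i => ∑ j, X i j ^ 2)
            (fun _ _ => Finset.sum_nonneg fun _ _ => sq_nonneg _) (Finset.mem_univ i)
      _ ≤ 1 := hX
  have hyk : |y k| ≤ 1 := by
    rw [← sq_le_one_iff_abs_le_one]
    exact (Finset.single_le_sum (f := fun k => y k ^ 2) (fun _ _ => sq_nonneg _)
      (Finset.mem_univ k)).trans hy
  calc A i j k * X i j * y k ≤ |A i j k * X i j * y k| := le_abs_self _
    _ = |A i j k| * |X i j| * |y k| := by rw [abs_mul, abs_mul]
    _ ≤ |A i j k| * 1 * 1 := by gcongr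
    _ = |A i j k| := by ring

lemma sum_sq_trace_le {d : ℕ} (A : Fin d → Fin d → Fin d → ℝ) :
    ∑ k, (∑ i, A i i k) ^ 2 ≤ d * norm12_3 A ^ 2 := by
  set T := ∑ k, (∑ i, A i i k) ^ 2 with hT
  have hT0 : 0 ≤ T := by positivity
  rcases hT0.eq_or_lt with h0 | hpos
  · rw [← h0]; positivity
  have hd : (0 : ℝ) < d := by
    rcases Nat.eq_zero_or_pos d with rfl | h
    · simp [hT] at hpos
    · exact_mod_cast h
  have hle : (√d)⁻¹ * (√T)⁻¹ * T ≤ norm12_3 A := by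
    refine le_csSup (bddAbove_norm12_3 A)
      ⟨fun i j => if i = j then (√d)⁻¹ else 0, fun k => (√T)⁻¹ * ∑ i, A i i k, ?_, ?_, ?_⟩
    · simp [inv_pow, Real.sq_sqrt hd.le, hd.ne']
    · simp_rw [mul_pow, ← Finset.mul_sum, ← hT, inv_pow, Real.sq_sqrt hT0]
      rw [inv_mul_cancel₀ hpos.ne']
    · have h1 : ∀ i, ∑ j, ∑ k, A i j k * (if i = j then (√d)⁻¹ else 0) *
          ((√T)⁻¹ * ∑ i, A i i k) = ∑ k, A i i k * (√d)⁻¹ * ((√T)⁻¹ * ∑ i, A i i k) := by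
        intro i
        rw [Finset.sum_eq_single i (fun j _ hj => by simp [hj.symm]) (by simp)]
        simp
      simp_rw [h1]
      rw [Finset.sum_comm, hT, Finset.mul_sum]
      refine Finset.sum_congr rfl fun k _ => ?_
      rw [← Finset.sum_mul, ← Finset.sum_mul]
      ring
  have hsq : T / d = ((√d)⁻¹ * (√T)⁻¹ * T) ^ 2 := by
    rw [mul_pow, mul_pow, inv_pow, inv_pow, Real.sq_sqrt hT0, Real.sq_sqrt hd.le]
    field_simp
  rw [← div_le_iff₀' hd, hsq]
  gcongr

end MomentBounds

/-- **Lemma (Gaussian moment bound for `‖∇³f_x[p,p,·]‖`).** -/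
theorem third_derivative_vector_form_moment_bound :
    ∃ c : ℝ, 0 < c ∧
    ∀ (d : ℕ) (ℓ : ℕ) (f : Euc d → ℝ) (x : Euc d),
      1 ≤ ℓ → ContDiff ℝ 3 f →
      (∫⁻ p : Euc d,
          ENNReal.ofReal
            ((Real.sqrt (∑ k, (∑ i, ∑ j, tensor3 f x i j k * p i * p j) ^ 2)) ^ (2 * ℓ))
          ∂(stdGaussian d)) ^ ((ℓ : ℝ)⁻¹)
        ≤ ENNReal.ofReal (c * ((ℓ : ℝ) ^ 2 * norm123 (tensor3 f x) ^ 2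
            + (ℓ : ℝ) ^ 2 * (d : ℝ) * norm12_3 (tensor3 f x) ^ 2)) := by
  refine ⟨2048, by norm_num, fun d ℓ f x hℓ _ => ?_⟩
  set A := tensor3 f x
  have hℓ1 : (1 : ℝ) ≤ ℓ := by exact_mod_cast hℓ
  have h := eLpNorm_sqrt_sum_sq_le (μ := stdGaussian d) hℓ
    (X := fun k (p : Euc d) => ∑ i, ∑ j, A i j k * p i * p j)
    (a := fun k => |∑ i, A i i k| + 32 * ℓ * √(∑ i, ∑ j, A i j k ^ 2))
    (fun k => by fun_prop) (fun k => by positivity)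
    fun k => eLpNorm_quadratic_le hℓ fun i j => A i j k
  have hint : ∫⁻ p : Euc d, ENNReal.ofReal
      ((√(∑ k, (∑ i, ∑ j, A i j k * p i * p j) ^ 2)) ^ (2 * ℓ)) ∂(stdGaussian d) =
      eLpNorm (fun p : Euc d => √(∑ k, (∑ i, ∑ j, A i j k * p i * p j) ^ 2)) (2 * ℓ : ℕ)
        (stdGaussian d) ^ (2 * ℓ) := by
    rw [eLpNorm_natCast_pow _ (by omega)]
    refine lintegral_congr fun p => ?_
    rw [ENNReal.ofReal_pow (by positivity), Real.enorm_of_nonneg (by positivity)]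
  rw [hint, pow_mul, ← ENNReal.rpow_natCast _ ℓ, ← ENNReal.rpow_mul,
    mul_inv_cancel₀ (by positivity), ENNReal.rpow_one]
  refine (pow_le_pow_left' h 2).trans ?_
  rw [← ENNReal.ofReal_pow (by positivity), Real.sq_sqrt (by positivity)]
  refine ENNReal.ofReal_le_ofReal ?_
  have hA : norm123 A ^ 2 = ∑ k, ∑ i, ∑ j, A i j k ^ 2 := by
    rw [norm123, Real.sq_sqrt (by positivity)]
    exact (Finset.sum_congr rfl fun i _ => Finset.sum_comm).trans Finset.sum_comm
  calc ∑ k, (|∑ i, A i i k| + 32 * ℓ * √(∑ i, ∑ j, A i j k ^ 2)) ^ 2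
      ≤ ∑ k, (2 * (∑ i, A i i k) ^ 2 + 2048 * ℓ ^ 2 * ∑ i, ∑ j, A i j k ^ 2) := by
        gcongr with k
        have h1 := Real.sq_sqrt (show 0 ≤ ∑ i, ∑ j, A i j k ^ 2 by positivity)
        have h2 := sq_abs (∑ i, A i i k)
        nlinarith [sq_nonneg (|∑ i, A i i k| - 32 * ℓ * √(∑ i, ∑ j, A i j k ^ 2))]
    _ = 2 * ∑ k, (∑ i, A i i k) ^ 2 + 2048 * ℓ ^ 2 * norm123 A ^ 2 := by
        rw [Finset.sum_add_distrib, ← Finset.mul_sum, ← Finset.mul_sum, hA]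
    _ ≤ 2 * (d * norm12_3 A ^ 2) + 2048 * ℓ ^ 2 * norm123 A ^ 2 := by
        gcongr
        exact sum_sq_trace_le A
    _ ≤ 2048 * ℓ ^ 2 * (d * norm12_3 A ^ 2) + 2048 * ℓ ^ 2 * norm123 A ^ 2 := by
        gcongr
        nlinarith
    _ = 2048 * (ℓ ^ 2 * norm123 A ^ 2 + ℓ ^ 2 * d * norm12_3 A ^ 2) := by ring
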